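/- arXiv:2411.14424 — 7 statements merged into one kernel-verified Lean document; each statement's English description precedes it below -/
import Mathlib

section
/- Let d be a positive integer, let μ₊, μ₋, σ > 0 with μ₊ + μ₋ > 0, let α ∈ (0,1), let g ∈ (0,1], and set K = d·ln(α/(1−α)). Define R : ℝ → ℝ by R(t) = α·Φ((−t − d·μ₊)/(√(d·g)·σ)) + (1−α)·Φ((t − d·μ₋)/(√(d·g)·σ)). Then t* = (−d²(μ₊² − μ₋²) + 2K·σ²·g)/(2d(μ₊ + μ₋)) satisfies R′(t*) = 0, and moreover (−t* − d·μ₊)/(√(d·g)·σ) = (−d²(μ₊+μ₋)² − 2K·σ²·g)/(2σ(μ₊+μ₋)·√(d³·g)) and (t* − d·μ₋)/(√(d·g)·σ) = (−d²(μ₊+μ₋)² + 2K·σ²·g)/(2σ(μ₊+μ₋)·√(d³·g)); consequently the class-wise natural risks of the stationary classifier are R⁺ = Φ((−d²(μ₊+μ₋)² − 2Kσ²g)/(2σ(μ₊+μ₋)√(d³g))) and R⁻ = Φ((−d²(μ₊+μ₋)² + 2Kσ²g)/(2σ(μ₊+μ₋)√(d³g))). (Theorem 1 of the paper, equal-variance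 case.) -/
open MeasureTheory ProbabilityTheory Real

/-- The standard normal CDF: `Φ(x) = P(Z ≤ x)` for `Z ~ N(0,1)`. -/
noncomputable def stdNormalCDF (x : ℝ) : ℝ :=
  ((ProbabilityTheory.gaussianReal 0 1) (Set.Iic x)).toReal

/-- The standard normal CDF is differentiable with derivative the Gaussian density. -/
theorem hasDerivAt_stdNormalCDF (x : ℝ) :
    HasDerivAt stdNormalCDF (gaussianPDFReal 0 1 x) x := by
  have hint : Integrable (gaussianPDFReal 0 1) := integrable_gaussianPDFReal 0 1
  have hcont : Continuous (gaussianPDFReal 0 1) := by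
    unfold gaussianPDFReal
    fun_prop
  have hcdf : ∀ y, stdNormalCDF y = ∫ z in Set.Iic y, gaussianPDFReal 0 1 z := fun y => by
    rw [stdNormalCDF, gaussianReal_apply_eq_integral 0 one_ne_zero,
      ENNReal.toReal_ofReal (integral_nonneg fun z => gaussianPDFReal_nonneg 0 1 z)]
  have hsplit : stdNormalCDF = fun y =>
      stdNormalCDF 0 + ∫ z in (0 : ℝ)..y, gaussianPDFReal 0 1 z := by
    funext y
    rw [hcdf, hcdf, ← intervalIntegral.integral_Iic_sub_Iic hint.integrableOn hint.integrableOn]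
    ring
  rw [hsplit]
  exact (hcont.integral_hasStrictDerivAt 0 x).hasDerivAt.const_add _

/-- Weighted standard Gaussian densities agree when the half-difference of the squared arguments
is the log-odds of the weights. -/
theorem mul_gaussianPDFReal_eq_of_log_odds {α : ℝ} (hα : α ∈ Set.Ioo (0 : ℝ) 1) {a b : ℝ}
    (h : a ^ 2 - b ^ 2 = 2 * log (α / (1 - α))) :
    α * gaussianPDFReal 0 1 a = (1 - α) * gaussianPDFReal 0 1 b := by
  have hα' : 0 < 1 - α := sub_pos.2 hα.2
  have hexp : rexp (-b ^ 2 / 2) = α / (1 - α) * rexp (-a ^ 2 / 2) := by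
    conv_rhs => rw [← exp_log (div_pos hα.1 hα'), ← exp_add]
    congr 1
    linarith
  simp only [gaussianPDFReal, NNReal.coe_one, mul_one, sub_zero, hexp]
  field_simp

/-- Theorem 1 of the paper (equal-variance case): stationarity of `t*` for the domain-mixup
natural risk, and the resulting class-wise natural risks. -/
theorem domain_mixup_natural_training_equal_variance
    (d : ℕ) (hd : 0 < d) (μp μm σ : ℝ) (hμp : 0 < μp) (hμm : 0 < μm) (hσ : 0 < σ)
    (hsum : 0 < μp + μm) (α : ℝ) (hα : α ∈ Set.Ioo (0 : ℝ) 1)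
    (g : ℝ) (hg : g ∈ Set.Ioc (0 : ℝ) 1)
    (K : ℝ) (hK : K = d * Real.log (α / (1 - α)))
    (R : ℝ → ℝ)
    (hR : ∀ t, R t = α * stdNormalCDF ((-t - d * μp) / (Real.sqrt (d * g) * σ))
        + (1 - α) * stdNormalCDF ((t - d * μm) / (Real.sqrt (d * g) * σ)))
    (tstar : ℝ)
    (htstar : tstar = (-(d : ℝ)^2 * (μp^2 - μm^2) + 2 * K * σ^2 * g) / (2 * d * (μp + μm))) :
    deriv R tstar = 0
    ∧ (-tstar - d * μp) / (Real.sqrt (d * g) * σ)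
        = (-(d : ℝ)^2 * (μp + μm)^2 - 2 * K * σ^2 * g)
            / (2 * σ * (μp + μm) * Real.sqrt ((d : ℝ)^3 * g))
    ∧ (tstar - d * μm) / (Real.sqrt (d * g) * σ)
        = (-(d : ℝ)^2 * (μp + μm)^2 + 2 * K * σ^2 * g)
            / (2 * σ * (μp + μm) * Real.sqrt ((d : ℝ)^3 * g))
    ∧ stdNormalCDF ((-tstar - d * μp) / (Real.sqrt (d * g) * σ))
        = stdNormalCDF ((-(d : ℝ)^2 * (μp + μm)^2 - 2 * K * σ^2 * g)
            / (2 * σ * (μp + μm) * Real.sqrt ((d : ℝ)^3 * g)))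
    ∧ stdNormalCDF ((tstar - d * μm) / (Real.sqrt (d * g) * σ))
        = stdNormalCDF ((-(d : ℝ)^2 * (μp + μm)^2 + 2 * K * σ^2 * g)
            / (2 * σ * (μp + μm) * Real.sqrt ((d : ℝ)^3 * g))) := by
  have hd' : (0 : ℝ) < d := Nat.cast_pos.2 hd
  have hg0 : 0 < g := hg.1
  have hc : 0 < √(d * g) := sqrt_pos.2 (mul_pos hd' hg0)
  have hsqrt : √((d : ℝ) ^ 3 * g) = d * √(d * g) := by
    rw [show (d : ℝ) ^ 3 * g = d ^ 2 * (d * g) by ring, sqrt_mul (sq_nonneg _),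
      sqrt_sq hd'.le]
  have hp : (-tstar - d * μp) / (√(d * g) * σ)
      = (-(d : ℝ)^2 * (μp + μm)^2 - 2 * K * σ^2 * g)
          / (2 * σ * (μp + μm) * √((d : ℝ)^3 * g)) := by
    rw [hsqrt, htstar]
    field_simp
    ring
  have hm : (tstar - d * μm) / (√(d * g) * σ)
      = (-(d : ℝ)^2 * (μp + μm)^2 + 2 * K * σ^2 * g)
          / (2 * σ * (μp + μm) * √((d : ℝ)^3 * g)) := by
    rw [hsqrt, htstar]
    field_simp
    ring
  refine ⟨?_, hp, hm, congrArg _ hp, congrArg _ hm⟩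
  have hodds : ((-tstar - d * μp) / (√(d * g) * σ)) ^ 2 - ((tstar - d * μm) / (√(d * g) * σ)) ^ 2
      = 2 * log (α / (1 - α)) := by
    rw [div_pow, div_pow, mul_pow, sq_sqrt (mul_pos hd' hg0).le, htstar, hK]
    field_simp
    ring
  have hbal := mul_gaussianPDFReal_eq_of_log_odds hα hodds
  have hdp : HasDerivAt (fun t : ℝ => (-t - d * μp) / (√(d * g) * σ))
      (-1 / (√(d * g) * σ)) tstar :=
    ((hasDerivAt_id tstar).neg.sub_const _).div_const _
  have hdm : HasDerivAt (fun t : ℝ => (t - d * μm) / (√(d * g) * σ))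
      (1 / (√(d * g) * σ)) tstar :=
    ((hasDerivAt_id tstar).sub_const _).div_const _
  have hRderiv :=
    (((hasDerivAt_stdNormalCDF _).comp tstar hdp).const_mul α).add
      (((hasDerivAt_stdNormalCDF _).comp tstar hdm).const_mul (1 - α))
  rw [funext hR]
  refine hRderiv.deriv.trans ?_
  linear_combination (-1 / (√(d * g) * σ)) * hbal
end

section
/- Let d be a positive integer, let μ₊, μ₋, σ > 0, let ε ≥ 0 with μ₊ + μ₋ − 2ε > 0, let α ∈ (0,1), let g ∈ (0,1], and set K = d·ln(α/(1−α)) and M′ = d²(μ₊+μ₋−2ε)². Define R : ℝ → ℝ by R(s) = α·Φ((−s − d(μ₊−ε))/(√(d·g)·σ)) + (1−α)·Φ((s − d(μ₋−ε))/(√(d·g)·σ)). Then s* = (−d²((μ₊−ε)² − (μ₋−ε)²) + 2K·σ²·g)/(2d(μ₊+μ₋−2ε)) satisfies R′(s*) = 0, and moreover (−s* − d(μ₊−ε))/(√(dg)σ) = (−M′ − 2Kσ²g)/(2σ(μ₊+μ₋−2ε)√(d³g)) and (s* − d(μ₋−ε))/(√(dg)σ) = (−M′ + 2Kσ²g)/(2σ(μ₊+μ₋−2ε)√(d³g));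 consequently the class-wise adversarial risks of the stationary classifier are R⁺ = Φ((−M′ − 2Kσ²g)/(2σ(μ₊+μ₋−2ε)√(d³g))) and R⁻ = Φ((−M′ + 2Kσ²g)/(2σ(μ₊+μ₋−2ε)√(d³g))). (Theorem 2 of the paper, equal-variance case.) -/
open MeasureTheory ProbabilityTheory Real

theorem continuous_gaussianPDFReal (m : ℝ) (v : NNReal) :
    Continuous (gaussianPDFReal m v) := by
  unfold gaussianPDFReal
  fun_prop

theorem stdNormalCDF_eq_integral (x : ℝ) :
    stdNormalCDF x = ∫ t in Set.Iic x, gaussianPDFReal 0 1 t := by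
  rw [stdNormalCDF, gaussianReal_apply_eq_integral 0 one_ne_zero, ENNReal.toReal_ofReal]
  exact setIntegral_nonneg measurableSet_Iic fun t _ => gaussianPDFReal_nonneg 0 1 t

theorem mul_gaussianPDFReal_eq_of_sq_sub_sq {α x y : ℝ} (hα : α ∈ Set.Ioo (0 : ℝ) 1)
    (h : x ^ 2 - y ^ 2 = 2 * Real.log (α / (1 - α))) :
    α * gaussianPDFReal 0 1 x = (1 - α) * gaussianPDFReal 0 1 y := by
  have hα0 : 0 < α := hα.1
  have hα1 : 0 < 1 - α := sub_pos.2 hα.2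
  have hexp : α * Real.exp (-x ^ 2 / 2) = (1 - α) * Real.exp (-y ^ 2 / 2) := by
    have hy : -y ^ 2 / 2 = Real.log (α / (1 - α)) + -x ^ 2 / 2 := by linarith
    rw [hy, Real.exp_add, Real.exp_log (div_pos hα0 hα1)]
    field_simp
  simp only [gaussianPDFReal, NNReal.coe_one, mul_one, sub_zero]
  linear_combination (√(2 * π))⁻¹ * hexp

/-- Theorem 2 of the paper (equal-variance case): stationarity of `s*` for the domain-mixup
adversarial risk, and the resulting class-wise adversarial risks. -/
theorem domain_mixup_adversarial_training_equal_variance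
    (d : ℕ) (hd : 0 < d) (μp μm σ : ℝ) (hμp : 0 < μp) (hμm : 0 < μm) (hσ : 0 < σ)
    (ε : ℝ) (hε : 0 ≤ ε) (hsum : 0 < μp + μm - 2 * ε)
    (α : ℝ) (hα : α ∈ Set.Ioo (0 : ℝ) 1) (g : ℝ) (hg : g ∈ Set.Ioc (0 : ℝ) 1)
    (K : ℝ) (hK : K = d * Real.log (α / (1 - α)))
    (M' : ℝ) (hM' : M' = (d : ℝ)^2 * (μp + μm - 2 * ε)^2)
    (R : ℝ → ℝ)
    (hR : ∀ s, R s = α * stdNormalCDF ((-s - d * (μp - ε)) / (Real.sqrt (d * g) * σ))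
        + (1 - α) * stdNormalCDF ((s - d * (μm - ε)) / (Real.sqrt (d * g) * σ)))
    (sstar : ℝ)
    (hsstar : sstar = (-(d : ℝ)^2 * ((μp - ε)^2 - (μm - ε)^2) + 2 * K * σ^2 * g)
        / (2 * d * (μp + μm - 2 * ε))) :
    deriv R sstar = 0
    ∧ (-sstar - d * (μp - ε)) / (Real.sqrt (d * g) * σ)
        = (-M' - 2 * K * σ^2 * g)
            / (2 * σ * (μp + μm - 2 * ε) * Real.sqrt ((d : ℝ)^3 * g))
    ∧ (sstar - d * (μm - ε)) / (Real.sqrt (d * g) * σ)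
        = (-M' + 2 * K * σ^2 * g)
            / (2 * σ * (μp + μm - 2 * ε) * Real.sqrt ((d : ℝ)^3 * g))
    ∧ stdNormalCDF ((-sstar - d * (μp - ε)) / (Real.sqrt (d * g) * σ))
        = stdNormalCDF ((-M' - 2 * K * σ^2 * g)
            / (2 * σ * (μp + μm - 2 * ε) * Real.sqrt ((d : ℝ)^3 * g)))
    ∧ stdNormalCDF ((sstar - d * (μm - ε)) / (Real.sqrt (d * g) * σ))
        = stdNormalCDF ((-M' + 2 * K * σ^2 * g)
            / (2 * σ * (μp + μm - 2 * ε) * Real.sqrt ((d : ℝ)^3 * g))) := by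
  have hd0 : (0 : ℝ) < d := by exact_mod_cast hd
  have hg0 : 0 < g := hg.1
  obtain ⟨S, rfl⟩ : ∃ S, μp = S - μm + 2 * ε := ⟨μp + μm - 2 * ε, by ring⟩
  rw [show S - μm + 2 * ε + μm - 2 * ε = S by ring] at *
  have hc : 0 < √(d * g) := Real.sqrt_pos.2 (mul_pos hd0 hg0)
  have hc2 : √(d * g) ^ 2 = d * g := Real.sq_sqrt (mul_pos hd0 hg0).le
  have hcube : √((d : ℝ) ^ 3 * g) = d * √(d * g) := by
    rw [show (d : ℝ) ^ 3 * g = (d : ℝ) ^ 2 * (d * g) by ring,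
      Real.sqrt_mul (sq_nonneg _), Real.sqrt_sq hd0.le]
  have hp : (-sstar - d * (S - μm + 2 * ε - ε)) / (√(d * g) * σ) = (-M' - 2 * K * σ^2 * g)
      / (2 * σ * S * √((d : ℝ)^3 * g)) := by
    rw [hcube, hsstar, hM']
    field_simp
    ring
  have hm : (sstar - d * (μm - ε)) / (√(d * g) * σ) = (-M' + 2 * K * σ^2 * g)
      / (2 * σ * S * √((d : ℝ)^3 * g)) := by
    rw [hcube, hsstar, hM']
    field_simp
    ring
  refine ⟨?_, hp, hm, congrArg _ hp, congrArg _ hm⟩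
  have hsq : ((-sstar - d * (S - μm + 2 * ε - ε)) / (√(d * g) * σ)) ^ 2
      - ((sstar - d * (μm - ε)) / (√(d * g) * σ)) ^ 2 = 2 * Real.log (α / (1 - α)) := by
    rw [div_pow, div_pow, mul_pow, hc2, hsstar, hK]
    field_simp
    ring
  have hinnerp : HasDerivAt (fun s : ℝ => (-s - d * (S - μm + 2 * ε - ε)) / (√(d * g) * σ))
      (-1 / (√(d * g) * σ)) sstar :=
    ((hasDerivAt_id sstar).neg.sub_const _).div_const _
  have hinnerm : HasDerivAt (fun s : ℝ => (s - d * (μm - ε)) / (√(d * g) * σ))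
      (1 / (√(d * g) * σ)) sstar :=
    ((hasDerivAt_id sstar).sub_const _).div_const _
  have hderiv := (((hasDerivAt_stdNormalCDF _).comp sstar hinnerp).const_mul α).add
    (((hasDerivAt_stdNormalCDF _).comp sstar hinnerm).const_mul (1 - α))
  rw [funext hR]
  refine (hderiv.congr_deriv ?_).deriv
  linear_combination
    (-1 / (√(d * g) * σ)) * mul_gaussianPDFReal_eq_of_sq_sub_sq hα hsq
end

section
/- Let d be a positive integer, let μ₊, μ₋, σ > 0 with μ₊ + μ₋ > 0, let α ∈ (0,1), and set K = d·ln(α/(1−α)). Define R : ℝ → ℝ by R(t) = α·Φ((−t − d·μ₊)/(√d·σ)) + (1−α)·Φ((t − d·μ₋)/(√d·σ)). Then t* = (−d²(μ₊² − μ₋²) + 2K·σ²)/(2d(μ₊+μ₋)) satisfies R′(t*) = 0, and the corresponding class-wise natural risks are Φ((−t* − dμ₊)/(√d·σ)) = Φ((−d²(μ₊+μ₋)² − 2Kσ²)/(2d^{3/2}σ(μ₊+μ₋))) and Φ((t* − dμ₋)/(√d·σ)) = Φ((−d²(μ₊+μ₋)² + 2Kσ²)/(2d^{3/2}σ(μ₊+μ₋))).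 (Proposition 1 of the paper: class-wise natural risk of the optimized linear classifier, σ₊ = σ₋ = σ.) -/
open MeasureTheory ProbabilityTheory Real

/-- Two weighted standard normal densities agree as soon as the log-ratio of the weights is half
the difference of the squared arguments. -/
theorem mul_gaussianPDFReal_eq_of_log_div {p q a b : ℝ} (hp : 0 < p) (hq : 0 < q)
    (h : a ^ 2 - b ^ 2 = 2 * Real.log (p / q)) :
    p * gaussianPDFReal 0 1 a = q * gaussianPDFReal 0 1 b := by
  rw [Real.log_div hp.ne' hq.ne'] at h
  have hexp : p * Real.exp (-a ^ 2 / 2) = q * Real.exp (-b ^ 2 / 2) := by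
    rw [← Real.exp_log hp, ← Real.exp_log hq, ← Real.exp_add, ← Real.exp_add]
    congr 1
    linarith
  simp only [gaussianPDFReal, sub_zero, NNReal.coe_one, mul_one]
  linear_combination (√(2 * π))⁻¹ * hexp

/-- Proposition 1 of the paper: class-wise natural risk of the optimized linear classifier in
the equal-variance case `σ₊ = σ₋ = σ`. -/
theorem classwise_natural_risk_optimal_linear
    (d : ℕ) (hd : 0 < d) (μp μm σ : ℝ) (hμp : 0 < μp) (hμm : 0 < μm) (hσ : 0 < σ)
    (hsum : 0 < μp + μm) (α : ℝ) (hα : α ∈ Set.Ioo (0 : ℝ) 1)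
    (K : ℝ) (hK : K = d * Real.log (α / (1 - α)))
    (R : ℝ → ℝ)
    (hR : ∀ t, R t = α * stdNormalCDF ((-t - d * μp) / (Real.sqrt d * σ))
        + (1 - α) * stdNormalCDF ((t - d * μm) / (Real.sqrt d * σ)))
    (tstar : ℝ)
    (htstar : tstar = (-(d : ℝ)^2 * (μp^2 - μm^2) + 2 * K * σ^2) / (2 * d * (μp + μm))) :
    deriv R tstar = 0
    ∧ stdNormalCDF ((-tstar - d * μp) / (Real.sqrt d * σ))
        = stdNormalCDF ((-(d : ℝ)^2 * (μp + μm)^2 - 2 * K * σ^2)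
            / (2 * (d : ℝ) ^ ((3 : ℝ) / 2) * σ * (μp + μm)))
    ∧ stdNormalCDF ((tstar - d * μm) / (Real.sqrt d * σ))
        = stdNormalCDF ((-(d : ℝ)^2 * (μp + μm)^2 + 2 * K * σ^2)
            / (2 * (d : ℝ) ^ ((3 : ℝ) / 2) * σ * (μp + μm))) := by
  obtain ⟨hα0, hα1⟩ := hα
  have hd' : (0 : ℝ) < d := by exact_mod_cast hd
  have hsqrt : 0 < √(d : ℝ) := Real.sqrt_pos.2 hd'
  have hsq : √(d : ℝ) ^ 2 = d := Real.sq_sqrt hd'.le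
  have hpow : (d : ℝ) ^ ((3 : ℝ) / 2) = d * √(d : ℝ) := by
    rw [show (3 : ℝ) / 2 = 1 + 1 / 2 by norm_num, Real.rpow_add hd', Real.rpow_one,
      ← Real.sqrt_eq_rpow]
  refine ⟨?_, ?_, ?_⟩
  · have hp : HasDerivAt (fun t : ℝ => (-t - d * μp) / (√(d : ℝ) * σ))
        (-1 / (√(d : ℝ) * σ)) tstar :=
      ((hasDerivAt_id tstar).neg.sub_const _).div_const _
    have hm : HasDerivAt (fun t : ℝ => (t - d * μm) / (√(d : ℝ) * σ))
        (1 / (√(d : ℝ) * σ)) tstar :=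
      ((hasDerivAt_id tstar).sub_const _).div_const _
    have hderiv := (((hasDerivAt_stdNormalCDF _).comp tstar hp).const_mul α).add
      (((hasDerivAt_stdNormalCDF _).comp tstar hm).const_mul (1 - α))
    have hbalance := mul_gaussianPDFReal_eq_of_log_div hα0 (sub_pos.2 hα1)
      (a := (-tstar - d * μp) / (√(d : ℝ) * σ)) (b := (tstar - d * μm) / (√(d : ℝ) * σ)) (by
        rw [div_pow, div_pow, mul_pow, hsq, htstar, hK]
        field_simp
        ring)
    rw [show R = _ from funext hR]
    refine hderiv.deriv.trans ?_
    linear_combination (-1 / (√(d : ℝ) * σ)) * hbalance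
  · rw [hpow, htstar]
    congr 1
    field_simp
    ring
  · rw [hpow, htstar]
    congr 1
    field_simp
    ring
end

section
/- Let d be a positive integer, let μ₊, μ₋, σ > 0, let ε ≥ 0 with μ₊ + μ₋ − 2ε > 0, let α ∈ (0,1), and set K = d·ln(α/(1−α)) and M′ = d²(μ₊+μ₋−2ε)². Define R : ℝ → ℝ by R(s) = α·Φ((−s − d(μ₊−ε))/(√d·σ)) + (1−α)·Φ((s − d(μ₋−ε))/(√d·σ)). Then s* = (−d²((μ₊−ε)² − (μ₋−ε)²) + 2K·σ²)/(2d(μ₊+μ₋−2ε)) satisfies R′(s*) = 0, and the corresponding class-wise adversarial risks are Φ((−s* − d(μ₊−ε))/(√d·σ)) = Φ((−M′ − 2Kσ²)/(2d^{3/2}σ(μ₊+μ₋−2ε))) and Φ((s* − d(μ₋−ε))/(√d·σ)) = Φ((−M′ + 2Kσ²)/(2d^{3/2}σ(μ₊+μ₋−2ε))). (Proposition 2 of the paper: class-wise adversarial risk of the optimized linear classifier, σ₊ = σ₋ = σ.) -/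
open MeasureTheory ProbabilityTheory Real

/-- Two weighted standard normal densities agree when the log-odds of the weights equal
half the difference of the squared arguments. -/
theorem mul_gaussianPDFReal_eq_of_log_eq {α u v : ℝ} (hα : α ∈ Set.Ioo (0 : ℝ) 1)
    (h : Real.log (α / (1 - α)) = (u ^ 2 - v ^ 2) / 2) :
    α * gaussianPDFReal 0 1 u = (1 - α) * gaussianPDFReal 0 1 v := by
  have hα' : 0 < 1 - α := sub_pos.2 hα.2
  have hodds : α = (1 - α) * Real.exp ((u ^ 2 - v ^ 2) / 2) := by
    rw [← h, Real.exp_log (div_pos hα.1 hα'), mul_div_cancel₀ _ hα'.ne']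
  have hexp : Real.exp (-v ^ 2 / 2) =
      Real.exp ((u ^ 2 - v ^ 2) / 2) * Real.exp (-u ^ 2 / 2) := by
    rw [← Real.exp_add]
    ring_nf
  simp only [gaussianPDFReal, NNReal.coe_one, mul_one, sub_zero]
  rw [hexp]
  linear_combination (√(2 * π))⁻¹ * Real.exp (-u ^ 2 / 2) * hodds

/-- Proposition 2 of the paper: class-wise adversarial risk of the optimized linear classifier
in the equal-variance case `σ₊ = σ₋ = σ`. -/
theorem classwise_adversarial_risk_optimal_linear
    (d : ℕ) (hd : 0 < d) (μp μm σ : ℝ) (hμp : 0 < μp) (hμm : 0 < μm) (hσ : 0 < σ)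
    (ε : ℝ) (hε : 0 ≤ ε) (hsum : 0 < μp + μm - 2 * ε)
    (α : ℝ) (hα : α ∈ Set.Ioo (0 : ℝ) 1)
    (K : ℝ) (hK : K = d * Real.log (α / (1 - α)))
    (M' : ℝ) (hM' : M' = (d : ℝ)^2 * (μp + μm - 2 * ε)^2)
    (R : ℝ → ℝ)
    (hR : ∀ s, R s = α * stdNormalCDF ((-s - d * (μp - ε)) / (Real.sqrt d * σ))
        + (1 - α) * stdNormalCDF ((s - d * (μm - ε)) / (Real.sqrt d * σ)))
    (sstar : ℝ)
    (hsstar : sstar = (-(d : ℝ)^2 * ((μp - ε)^2 - (μm - ε)^2) + 2 * K * σ^2)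
        / (2 * d * (μp + μm - 2 * ε))) :
    deriv R sstar = 0
    ∧ stdNormalCDF ((-sstar - d * (μp - ε)) / (Real.sqrt d * σ))
        = stdNormalCDF ((-M' - 2 * K * σ^2)
            / (2 * (d : ℝ) ^ ((3 : ℝ) / 2) * σ * (μp + μm - 2 * ε)))
    ∧ stdNormalCDF ((sstar - d * (μm - ε)) / (Real.sqrt d * σ))
        = stdNormalCDF ((-M' + 2 * K * σ^2)
            / (2 * (d : ℝ) ^ ((3 : ℝ) / 2) * σ * (μp + μm - 2 * ε))) := by
  have hd' : (0 : ℝ) < d := Nat.cast_pos.2 hd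
  have hsq : Real.sqrt d ^ 2 = (d : ℝ) := Real.sq_sqrt hd'.le
  have hsqrt : 0 < Real.sqrt d := Real.sqrt_pos.2 hd'
  have hpow : (d : ℝ) ^ ((3 : ℝ) / 2) = d * Real.sqrt d := by
    rw [Real.sqrt_eq_rpow, ← Real.rpow_one_add' hd'.le (by norm_num)]
    norm_num
  have hs : sstar * (2 * d * (μp + μm - 2 * ε)) =
      -(d : ℝ) ^ 2 * ((μp - ε) ^ 2 - (μm - ε) ^ 2) + 2 * K * σ ^ 2 := by
    rw [hsstar, div_mul_cancel₀ _ (by positivity)]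
  refine ⟨?_, ?_, ?_⟩
  · have hlog : Real.log (α / (1 - α)) =
        (((-sstar - d * (μp - ε)) / (Real.sqrt d * σ)) ^ 2
          - ((sstar - d * (μm - ε)) / (Real.sqrt d * σ)) ^ 2) / 2 := by
      rw [div_pow, div_pow, mul_pow, hsq]
      field_simp
      rw [hK] at hs
      linear_combination -hs
    have hbalance := mul_gaussianPDFReal_eq_of_log_eq hα hlog
    have hpos : HasDerivAt (fun s : ℝ => (-s - d * (μp - ε)) / (Real.sqrt d * σ))
        (-1 / (Real.sqrt d * σ)) sstar :=
      (((hasDerivAt_id sstar).neg).sub_const _).div_const _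
    have hneg : HasDerivAt (fun s : ℝ => (s - d * (μm - ε)) / (Real.sqrt d * σ))
        (1 / (Real.sqrt d * σ)) sstar :=
      ((hasDerivAt_id sstar).sub_const _).div_const _
    have hderiv := (((hasDerivAt_stdNormalCDF _).comp sstar hpos).const_mul α).add
      (((hasDerivAt_stdNormalCDF _).comp sstar hneg).const_mul (1 - α))
    rw [show R = _ from funext hR]
    refine hderiv.deriv.trans ?_
    linear_combination (-1 / (Real.sqrt d * σ)) * hbalance
  · congr 1
    rw [hpow, hM', div_eq_div_iff (by positivity) (by positivity)]
    linear_combination -(Real.sqrt d * σ) * hs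
  · congr 1
    rw [hpow, hM', div_eq_div_iff (by positivity) (by positivity)]
    linear_combination (Real.sqrt d * σ) * hs
end

section
/- Let d be a positive integer, let μ₊, μ₋, σ > 0 with m := μ₊ + μ₋ > 0, let K > 0, set D = d²m², and assume (d²m²/(2Kσ²))² ≤ g ≤ 1 (equivalently d⁴m⁴/(4K²σ⁴) ≤ g ≤ 1). Then the following chain of inequalities holds: Φ((−D − 2Kσ²)/(2d^{3/2}σm)) ≤ Φ((−D − 2Kσ²g)/(2σm√(d³g))) ≤ Φ((−D + 2Kσ²g)/(2σm√(d³g))) ≤ Φ((−D + 2Kσ²)/(2d^{3/2}σm)). That is, R⁺_nat(f*_nat) ≤ R⁺_nat(f*_smix) ≤ R⁻_nat(f*_smix) ≤ R⁻_nat(f*_nat): domain mixup training balances the class-wise natural risks. (Remark 2 of the paper.) -/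
open MeasureTheory ProbabilityTheory Real

theorem stdNormalCDF_mono : Monotone stdNormalCDF := fun _ _ h =>
  ENNReal.toReal_mono (measure_ne_top _ _) (measure_mono (Set.Iic_subset_Iic.mpr h))

/-- Rescaling the threshold: if `D ≤ B s` and `0 < s ≤ 1`, passing from noise level `1` to
noise level `s` increases the lower argument. -/
theorem neg_sub_le_neg_sub_sq_div {D B s : ℝ} (hs : 0 < s) (hs1 : s ≤ 1) (hD : D ≤ B * s) :
    -D - B ≤ (-D - B * s ^ 2) / s := by
  rw [le_div_iff₀ hs]
  nlinarith [mul_nonneg (sub_nonneg.2 hs1) (sub_nonneg.2 hD)]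

/-- If `0 ≤ D`, `0 ≤ B` and `0 < s ≤ 1`, passing from noise level `1` to noise level `s`
decreases the upper argument. -/
theorem neg_add_sq_div_le_neg_add {D B s : ℝ} (hs : 0 < s) (hs1 : s ≤ 1) (hD : 0 ≤ D)
    (hB : 0 ≤ B) : (-D + B * s ^ 2) / s ≤ -D + B := by
  rw [div_le_iff₀ hs]
  nlinarith [mul_nonneg (sub_nonneg.2 hs1) hD,
    mul_nonneg (sub_nonneg.2 hs1) (mul_nonneg hB hs.le)]

/-- Remark 2 of the paper: domain mixup training balances the class-wise natural risks,
i.e. `R⁺_nat(f*_nat) ≤ R⁺_nat(f*_smix) ≤ R⁻_nat(f*_smix) ≤ R⁻_nat(f*_nat)`. -/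
theorem mixup_balances_natural_risks
    (d : ℕ) (hd : 0 < d) (μp μm σ : ℝ) (hμp : 0 < μp) (hμm : 0 < μm) (hσ : 0 < σ)
    (m : ℝ) (hm : m = μp + μm) (hmpos : 0 < m)
    (K : ℝ) (hK : 0 < K)
    (D : ℝ) (hD : D = (d : ℝ)^2 * m^2)
    (g : ℝ) (hgl : ((d : ℝ)^2 * m^2 / (2 * K * σ^2))^2 ≤ g) (hgu : g ≤ 1) :
    stdNormalCDF ((-D - 2 * K * σ^2) / (2 * (d : ℝ) ^ ((3 : ℝ) / 2) * σ * m))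
      ≤ stdNormalCDF ((-D - 2 * K * σ^2 * g) / (2 * σ * m * Real.sqrt ((d : ℝ)^3 * g)))
    ∧ stdNormalCDF ((-D - 2 * K * σ^2 * g) / (2 * σ * m * Real.sqrt ((d : ℝ)^3 * g)))
      ≤ stdNormalCDF ((-D + 2 * K * σ^2 * g) / (2 * σ * m * Real.sqrt ((d : ℝ)^3 * g)))
    ∧ stdNormalCDF ((-D + 2 * K * σ^2 * g) / (2 * σ * m * Real.sqrt ((d : ℝ)^3 * g)))
      ≤ stdNormalCDF ((-D + 2 * K * σ^2) / (2 * (d : ℝ) ^ ((3 : ℝ) / 2) * σ * m)) := by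
  have hd' : (0 : ℝ) < d := Nat.cast_pos.2 hd
  have hDpos : 0 < D := hD ▸ by positivity
  have hB : 0 < 2 * K * σ ^ 2 := by positivity
  rw [← hD] at hgl
  have hg : 0 < g := lt_of_lt_of_le (by positivity) hgl
  have hs : 0 < √g := Real.sqrt_pos.2 hg
  have hs1 : √g ≤ 1 := Real.sqrt_le_one.2 hgu
  have hDs : D ≤ 2 * K * σ ^ 2 * √g := by
    rw [mul_comm, ← div_le_iff₀ hB]
    exact Real.le_sqrt_of_sq_le hgl
  have hc : 0 < 2 * (d : ℝ) ^ ((3 : ℝ) / 2) * σ * m := by positivity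
  have hden : 2 * σ * m * √((d : ℝ) ^ 3 * g) = √g * (2 * (d : ℝ) ^ ((3 : ℝ) / 2) * σ * m) := by
    have hpow : (d : ℝ) ^ ((3 : ℝ) / 2) = √((d : ℝ) ^ 3) := by
      rw [Real.rpow_div_two_eq_sqrt _ hd'.le, Real.sqrt_eq_rpow, Real.sqrt_eq_rpow,
        ← Real.rpow_natCast, ← Real.rpow_mul hd'.le, ← Real.rpow_mul hd'.le]
      norm_num
    rw [Real.sqrt_mul (by positivity), hpow]
    ring
  have hsq : √g ^ 2 = g := Real.sq_sqrt hg.le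
  refine ⟨stdNormalCDF_mono ?_, stdNormalCDF_mono ?_, stdNormalCDF_mono ?_⟩
  · rw [hden, ← div_div _ (√g)]
    refine div_le_div_of_nonneg_right ?_ hc.le
    simpa only [hsq] using neg_sub_le_neg_sub_sq_div hs hs1 hDs
  · have : 0 < 2 * K * σ ^ 2 * g := by positivity
    gcongr
    linarith
  · rw [hden, ← div_div _ (√g)]
    refine div_le_div_of_nonneg_right ?_ hc.le
    simpa only [hsq] using neg_add_sq_div_le_neg_add hs hs1 hDpos.le hB.le
end

section
/- Let d be a positive integer, let μ₊, μ₋, σ > 0, let ε ≥ 0 with μ₊ + μ₋ − 2ε > 0, let K > 0, and let g ∈ (0,1]. Then |2·Φ(−2Kσ²·√g/(2d^{3/2}σ(μ₊+μ₋−2ε))) − 1| ≤ |2·Φ(−2Kσ²/(2d^{3/2}σ(μ₊+μ₋−2ε))) − 1|. That is, the class-wise adversarial risk gap of the domain-mixup adversarially trained optimal linear classifier, Δ_adv(f*_smix), is at most the class-wise adversarial risk gap of the adversarially trained optimal linear classifier, Δ_adv(f*_adv). (Remark 3 of the paper.) -/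
open MeasureTheory ProbabilityTheory Real

theorem stdNormalCDF_neg (x : ℝ) : stdNormalCDF (-x) = 1 - stdNormalCDF x := by
  have : NullSingletonClass (gaussianReal 0 1) := nullSingletonClass_gaussianReal one_ne_zero
  have hmap : (gaussianReal 0 1).map (fun y : ℝ => -y) = gaussianReal 0 1 := by
    rw [gaussianReal_map_neg, neg_zero]
  have hpre : (fun y : ℝ => -y) ⁻¹' Set.Iic (-x) = Set.Ici x := by
    ext y
    simp
  have hrefl : (gaussianReal 0 1) (Set.Iic (-x)) = (gaussianReal 0 1) (Set.Ioi x) := by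
    conv_lhs => rw [← hmap]
    rw [Measure.map_apply measurable_neg measurableSet_Iic, hpre]
    exact (measure_congr Ioi_ae_eq_Ici).symm
  have hcompl := probReal_compl_eq_one_sub (μ := gaussianReal 0 1) (measurableSet_Iic (a := x))
  rw [Set.compl_Iic] at hcompl
  rw [stdNormalCDF, hrefl]
  exact hcompl

theorem stdNormalCDF_zero : stdNormalCDF 0 = 1 / 2 := by
  have h := stdNormalCDF_neg 0
  rw [neg_zero] at h
  linarith

theorem antitoneOn_abs_two_mul_stdNormalCDF_sub_one :
    AntitoneOn (fun x => |2 * stdNormalCDF x - 1|) (Set.Iic 0) := by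
  intro a _ b hb hab
  have h₁ := stdNormalCDF_mono hab
  have h₂ := stdNormalCDF_mono (Set.mem_Iic.1 hb)
  rw [stdNormalCDF_zero] at h₂
  dsimp only
  rw [abs_of_nonpos (by linarith), abs_of_nonpos (by linarith)]
  linarith

/-- Remark 3 of the paper: the class-wise adversarial risk gap of the domain-mixup
adversarially trained optimal linear classifier is at most that of the adversarially
trained optimal linear classifier. -/
theorem mixup_reduces_adversarial_risk_gap
    (d : ℕ) (hd : 0 < d) (μp μm σ : ℝ) (hμp : 0 < μp) (hμm : 0 < μm) (hσ : 0 < σ)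
    (ε : ℝ) (hε : 0 ≤ ε) (hsum : 0 < μp + μm - 2 * ε)
    (K : ℝ) (hK : 0 < K) (g : ℝ) (hg : g ∈ Set.Ioc (0 : ℝ) 1) :
    |2 * stdNormalCDF (-(2 * K * σ^2 * Real.sqrt g)
        / (2 * (d : ℝ) ^ ((3 : ℝ) / 2) * σ * (μp + μm - 2 * ε))) - 1|
      ≤ |2 * stdNormalCDF (-(2 * K * σ^2)
        / (2 * (d : ℝ) ^ ((3 : ℝ) / 2) * σ * (μp + μm - 2 * ε))) - 1| := by
  have hden : 0 ≤ 2 * (d : ℝ) ^ ((3 : ℝ) / 2) * σ * (μp + μm - 2 * ε) := by positivity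
  have hnum : 0 ≤ 2 * K * σ ^ 2 := by positivity
  refine antitoneOn_abs_two_mul_stdNormalCDF_sub_one
    (div_nonpos_of_nonpos_of_nonneg (neg_nonpos.2 hnum) hden)
    (div_nonpos_of_nonpos_of_nonneg (neg_nonpos.2 (mul_nonneg hnum (sqrt_nonneg g))) hden) ?_
  exact div_le_div_of_nonneg_right
    (neg_le_neg (mul_le_of_le_one_right hnum (sqrt_le_one.2 hg.2))) hden
end

section
/- Let d be a positive integer, let μ₊, μ₋, σ > 0, let ε ≥ 0 with μ₊ + μ₋ − 2ε > 0, let K > 0, set M′ = d²(μ₊+μ₋−2ε)² and B = M′²/(4K²σ⁴), and assume B ≤ g ≤ 1. Then the following chain of inequalities holds: Φ((−M′ − 2Kσ²)/(2d^{3/2}σ(μ₊+μ₋−2ε))) ≤ Φ((−M′ − 2Kσ²g)/(2σ(μ₊+μ₋−2ε)√(d³g))) ≤ Φ((−M′ + 2Kσ²g)/(2σ(μ₊+μ₋−2ε)√(d³g))) ≤ Φ((−M′ + 2Kσ²)/(2d^{3/2}σ(μ₊+μ₋−2ε))). That is, R⁺_adv(f*_adv) ≤ R⁺_adv(f*_smix)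 ≤ R⁻_adv(f*_smix) affected ≤ R⁻_adv(f*_adv): same-domain mixup adversarial training balances the class-wise adversarial risks. (Remark 4 of the paper.) -/
open MeasureTheory ProbabilityTheory Real

theorem Real.sqrt_pow_three_mul {x : ℝ} (hx : 0 ≤ x) (y : ℝ) :
    √(x ^ 3 * y) = x ^ ((3 : ℝ) / 2) * √y := by
  rw [Real.sqrt_mul (by positivity), Real.sqrt_eq_rpow (x ^ 3), ← Real.rpow_natCast,
    ← Real.rpow_mul hx]
  norm_num

/-- The scale `s` plays the role of the square root of the variance-reduction factor. -/
theorem neg_sub_div_le_neg_sub_mul_sq_div {m c s P : ℝ} (hP : 0 < P) (hs : 0 < s) (hs1 : s ≤ 1)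
    (hmc : m ≤ c * s) : (-m - c) / P ≤ (-m - c * s ^ 2) / (P * s) := by
  rw [div_le_div_iff₀ hP (mul_pos hP hs)]
  have h := mul_nonneg hP.le (mul_nonneg (sub_nonneg.2 hs1) (sub_nonneg.2 hmc))
  linear_combination h

theorem neg_add_mul_sq_div_le_neg_add_div {m c s P : ℝ} (hP : 0 < P) (hs : 0 < s) (hs1 : s ≤ 1)
    (hmc : 0 ≤ m + c * s) : (-m + c * s ^ 2) / (P * s) ≤ (-m + c) / P := by
  rw [div_le_div_iff₀ (mul_pos hP hs) hP]
  have h := mul_nonneg hP.le (mul_nonneg (sub_nonneg.2 hs1) hmc)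
  linear_combination h

/-- Remark 4 of the paper: same-domain mixup adversarial training balances the class-wise
adversarial risks, i.e. `R⁺_adv(f*_adv) ≤ R⁺_adv(f*_smix) ≤ R⁻_adv(f*_smix) ≤ R⁻_adv(f*_adv)`. -/
theorem mixup_balances_adversarial_risks
    (d : ℕ) (hd : 0 < d) (μp μm σ : ℝ) (hμp : 0 < μp) (hμm : 0 < μm) (hσ : 0 < σ)
    (ε : ℝ) (hε : 0 ≤ ε) (hsum : 0 < μp + μm - 2 * ε)
    (K : ℝ) (hK : 0 < K)
    (M' : ℝ) (hM' : M' = (d : ℝ)^2 * (μp + μm - 2 * ε)^2)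
    (B : ℝ) (hB : B = M'^2 / (4 * K^2 * σ^4))
    (g : ℝ) (hgl : B ≤ g) (hgu : g ≤ 1) :
    stdNormalCDF ((-M' - 2 * K * σ^2)
        / (2 * (d : ℝ) ^ ((3 : ℝ) / 2) * σ * (μp + μm - 2 * ε)))
      ≤ stdNormalCDF ((-M' - 2 * K * σ^2 * g)
        / (2 * σ * (μp + μm - 2 * ε) * Real.sqrt ((d : ℝ)^3 * g)))
    ∧ stdNormalCDF ((-M' - 2 * K * σ^2 * g)
        / (2 * σ * (μp + μm - 2 * ε) * Real.sqrt ((d : ℝ)^3 * g)))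
      ≤ stdNormalCDF ((-M' + 2 * K * σ^2 * g)
        / (2 * σ * (μp + μm - 2 * ε) * Real.sqrt ((d : ℝ)^3 * g)))
    ∧ stdNormalCDF ((-M' + 2 * K * σ^2 * g)
        / (2 * σ * (μp + μm - 2 * ε) * Real.sqrt ((d : ℝ)^3 * g)))
      ≤ stdNormalCDF ((-M' + 2 * K * σ^2)
        / (2 * (d : ℝ) ^ ((3 : ℝ) / 2) * σ * (μp + μm - 2 * ε))) := by
  have hd' : (0 : ℝ) < d := Nat.cast_pos.mpr hd
  have hM : 0 < M' := by rw [hM']; positivity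
  have hg : 0 < g := lt_of_lt_of_le (by rw [hB]; positivity) hgl
  have hs : 0 < √g := Real.sqrt_pos.2 hg
  have hs1 : √g ≤ 1 := Real.sqrt_le_one.mpr hgu
  have hc : 0 < 2 * K * σ ^ 2 := by positivity
  have hP : 0 < 2 * (d : ℝ) ^ ((3 : ℝ) / 2) * σ * (μp + μm - 2 * ε) := by positivity
  have hMs : M' ≤ 2 * K * σ ^ 2 * √g := by
    rw [← div_le_iff₀' hc]
    refine Real.le_sqrt_of_sq_le (le_of_eq_of_le ?_ hgl)
    rw [hB, div_pow]
    ring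
  have hden : 2 * σ * (μp + μm - 2 * ε) * √((d : ℝ) ^ 3 * g)
      = 2 * (d : ℝ) ^ ((3 : ℝ) / 2) * σ * (μp + μm - 2 * ε) * √g := by
    rw [Real.sqrt_pow_three_mul hd'.le]
    ring
  have hsq : √g ^ 2 = g := Real.sq_sqrt hg.le
  rw [hden]
  refine ⟨stdNormalCDF_mono ?_, stdNormalCDF_mono ?_, stdNormalCDF_mono ?_⟩
  · simpa only [hsq] using neg_sub_div_le_neg_sub_mul_sq_div hP hs hs1 hMs
  · have := mul_pos hc hg
    gcongr
    linarith
  · simpa only [hsq] using neg_add_mul_sq_div_le_neg_add_div hP hs hs1 (by positivity)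
end
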